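/- Let k be an integer with k < 0 and let a^e(n,k) denote the number of compositions in A(n,k) having an even number of parts. Then for every integer n ≥ 3, a^e(n,k) = 2·a(n−2,k) − a(n−2+k,k), with the conventions a(0,k) = 1 and a(m,k) = 0 for m < 0. -/

import Mathlib

/-- A composition of `n`: a list of positive integers summing to `n`. -/
def IsComposition (n : ℤ) (l : List ℕ) : Prop :=
  (∀ x ∈ l, 0 < x) ∧ (l.sum : ℤ) = n

/-- Generalized Arndt condition with integer shift `k`:
`c_{2i-1} > c_{2i} + k` for every pair of consecutive parts. -/
def ArndtCondK (k : ℤ) (l : List ℕ) : Prop :=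
  ∀ i : ℕ, 2 * i + 1 < l.length →
    (l.getD (2 * i + 1) 0 : ℤ) + k < (l.getD (2 * i) 0 : ℤ)

theorem arndtCondK_nil (k : ℤ) : ArndtCondK k [] := fun i hi => by simp at hi

theorem arndtCondK_singleton (k : ℤ) (c : ℕ) : ArndtCondK k [c] := fun i hi => by
  simp at hi

theorem arndtCondK_cons_cons (k : ℤ) (a b : ℕ) (l : List ℕ) :
    ArndtCondK k (a :: b :: l) ↔ (b : ℤ) + k < a ∧ ArndtCondK k l := by
  constructor
  · intro h
    refine ⟨by simpa using h 0 (by simp), fun i hi => ?_⟩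
    simpa [Nat.mul_add] using h (i + 1) (by simp only [List.length_cons]; omega)
  · rintro ⟨h0, h⟩ (_ | i) hi
    · simpa using h0
    · simpa [Nat.mul_add] using h i (by simp only [List.length_cons] at hi; omega)

/-- Flatten a list of pairs, followed by a trailing part `c` that is omitted when `c = 0`. -/
def flattenPairs : List (ℕ × ℕ) → ℕ → List ℕ
  | [], 0 => []
  | [], c + 1 => [c + 1]
  | q :: p, c => q.1 :: q.2 :: flattenPairs p c

/-- Group the entries of a list in consecutive pairs, with a trailing entry if the length is odd
(and `0` otherwise). -/
def groupPairs : List ℕ → List (ℕ × ℕ) × ℕ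
  | [] => ([], 0)
  | [c] => ([], c)
  | a :: b :: l => ((a, b) :: (groupPairs l).1, (groupPairs l).2)

theorem groupPairs_flattenPairs (p : List (ℕ × ℕ)) (c : ℕ) :
    groupPairs (flattenPairs p c) = (p, c) := by
  induction p with
  | nil => cases c <;> rfl
  | cons q p ih => simp [flattenPairs, groupPairs, ih]

theorem flattenPairs_groupPairs : ∀ l : List ℕ, (∀ x ∈ l, 0 < x) →
    flattenPairs (groupPairs l).1 (groupPairs l).2 = l
  | [], _ => rfl
  | [c + 1], _ => rfl
  | [0], h => by simp at h
  | a :: b :: l, h => by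
    simp [flattenPairs, groupPairs,
      flattenPairs_groupPairs l fun x hx => h x (by simp [hx])]

theorem even_length_flattenPairs (p : List (ℕ × ℕ)) (c : ℕ) :
    Even (flattenPairs p c).length ↔ c = 0 := by
  induction p with
  | nil => cases c <;> simp [flattenPairs]
  | cons q p ih => simpa [flattenPairs, Nat.even_add_one] using ih

/-- Both entries of a pair are positive and satisfy the Arndt condition. -/
def IsArndtPair (k : ℤ) (q : ℕ × ℕ) : Prop :=
  0 < q.1 ∧ 0 < q.2 ∧ (q.2 : ℤ) + k < q.1

/-- The grouped form of the elements of `A(n,k)`. -/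
def IsGroupedArndt (k n : ℤ) (x : List (ℕ × ℕ) × ℕ) : Prop :=
  (∀ q ∈ x.1, IsArndtPair k q) ∧ ((x.1.map fun q => (q.1 : ℤ) + q.2).sum + x.2 = n)

theorem isGroupedArndt_cons (k n : ℤ) (q : ℕ × ℕ) (p : List (ℕ × ℕ)) (c : ℕ) :
    IsGroupedArndt k n (q :: p, c) ↔
      IsArndtPair k q ∧ IsGroupedArndt k (n - q.1 - q.2) (p, c) := by
  simp only [IsGroupedArndt, List.forall_mem_cons, List.map_cons, List.sum_cons, and_assoc]
  refine and_congr_right fun _ => and_congr_right fun _ => ?_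
  constructor <;> intro h <;> linarith

theorem flattenPairs_mem_iff (k n : ℤ) (p : List (ℕ × ℕ)) (c : ℕ) :
    IsComposition n (flattenPairs p c) ∧ ArndtCondK k (flattenPairs p c) ↔
      IsGroupedArndt k n (p, c) := by
  induction p generalizing n with
  | nil =>
    cases c <;>
      simp [flattenPairs, IsComposition, IsGroupedArndt, arndtCondK_nil, arndtCondK_singleton]
  | cons q p ih =>
    rw [isGroupedArndt_cons, ← ih]
    simp only [flattenPairs, arndtCondK_cons_cons, IsComposition, IsArndtPair,
      List.forall_mem_cons, List.sum_cons, Nat.cast_add]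
    have : (q.1 : ℤ) + (q.2 + ((flattenPairs p c).sum : ℤ)) = n ↔
        ((flattenPairs p c).sum : ℤ) = n - q.1 - q.2 := by
      constructor <;> intro h <;> linarith
    tauto

/-- Grouping in pairs identifies `A(n,k)` with its grouped form. -/
def arndtEquivGrouped (k n : ℤ) :
    {l : List ℕ // IsComposition n l ∧ ArndtCondK k l} ≃
      {x : List (ℕ × ℕ) × ℕ // IsGroupedArndt k n x} where
  toFun l := ⟨groupPairs l.1, by
    rw [← Prod.mk.eta (p := groupPairs l.1), ← flattenPairs_mem_iff,
      flattenPairs_groupPairs _ l.2.1.1]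
    exact l.2⟩
  invFun x := ⟨flattenPairs x.1.1 x.1.2, (flattenPairs_mem_iff ..).2 x.2⟩
  left_inv l := Subtype.ext (flattenPairs_groupPairs _ l.2.1.1)
  right_inv x := Subtype.ext (groupPairs_flattenPairs ..)

/-- Grouping in pairs identifies the even-length elements of `A(n,k)` with the grouped forms
without trailing part. -/
def evenArndtEquivGrouped (k n : ℤ) :
    {l : List ℕ // IsComposition n l ∧ ArndtCondK k l ∧ Even l.length} ≃
      {x : List (ℕ × ℕ) × ℕ // IsGroupedArndt k n x ∧ x.2 = 0} where
  toFun l := ⟨groupPairs l.1, by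
    rw [← even_length_flattenPairs (groupPairs l.1).1 (groupPairs l.1).2,
      ← Prod.mk.eta (p := groupPairs l.1), ← flattenPairs_mem_iff,
      flattenPairs_groupPairs _ l.2.1.1, and_assoc]
    exact l.2⟩
  invFun x := ⟨flattenPairs x.1.1 x.1.2, by
    rw [← and_assoc, flattenPairs_mem_iff, even_length_flattenPairs]
    exact x.2⟩
  left_inv l := Subtype.ext (flattenPairs_groupPairs _ l.2.1.1)
  right_inv x := Subtype.ext (groupPairs_flattenPairs ..)

theorem finite_isComposition (n : ℤ) : {l : List ℕ | IsComposition n l}.Finite := by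
  refine (Set.finite_range fun c : Composition n.toNat => c.blocks).subset ?_
  rintro l ⟨hpos, hsum⟩
  exact ⟨⟨l, fun {i} hi => hpos i hi, by omega⟩, rfl⟩

instance finite_isGroupedArndt (k n : ℤ) :
    Finite {x : List (ℕ × ℕ) × ℕ // IsGroupedArndt k n x} := by
  have : Finite {l : List ℕ // IsComposition n l ∧ ArndtCondK k l} :=
    ((finite_isComposition n).subset fun _ h => h.1).to_subtype
  exact Finite.of_equiv _ (arndtEquivGrouped k n)

/-- Remove `(1, 1)` from the first pair of an even-length element, or enlarge the trailing part
by `j`. -/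
def shrinkPair (j : ℕ) : (List (ℕ × ℕ) × ℕ) ⊕ (List (ℕ × ℕ) × ℕ) →
    (List (ℕ × ℕ) × ℕ) ⊕ (List (ℕ × ℕ) × ℕ)
  | .inl ([], c) => .inl ([], c)
  | .inl ((a, b) :: p, _) =>
    if b = 1 then .inl (p, a - 1)
    else if a = 1 then .inr (p, b - 1)
    else .inr ((a - 1, b - 1) :: p, 0)
  | .inr (p, d) => .inr (p, d + j)

/-- The inverse of `shrinkPair`. -/
def growPair (j : ℕ) : (List (ℕ × ℕ) × ℕ) ⊕ (List (ℕ × ℕ) × ℕ) →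
    (List (ℕ × ℕ) × ℕ) ⊕ (List (ℕ × ℕ) × ℕ)
  | .inl (p, c) => .inl ((c + 1, 1) :: p, 0)
  | .inr ([], 0) => .inr ([], 0)
  | .inr ((a, b) :: p, 0) => .inl ((a + 1, b + 1) :: p, 0)
  | .inr (p, c + 1) => if c + 1 < j then .inl ((1, c + 2) :: p, 0) else .inr (p, c + 1 - j)

theorem IsGroupedArndt.of_add_eq {k n m : ℤ} {p : List (ℕ × ℕ)} {c d : ℕ}
    (h : IsGroupedArndt k n (p, c)) (hd : n + d = m + c) : IsGroupedArndt k m (p, d) :=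
  ⟨h.1, by have := h.2; dsimp only at this ⊢; linarith⟩

/-- `shrinkPair` is a bijection between the two sides of the recurrence for even-length
elements. -/
def shrinkPairEquiv (j : ℕ) (hj : 0 < j) (n : ℤ) (hn : 3 ≤ n) :
    {s : (List (ℕ × ℕ) × ℕ) ⊕ (List (ℕ × ℕ) × ℕ) //
      Sum.elim (fun x => IsGroupedArndt (-j) n x ∧ x.2 = 0)
        (IsGroupedArndt (-j) (n - 2 + -j)) s} ≃
    {s : (List (ℕ × ℕ) × ℕ) ⊕ (List (ℕ × ℕ) × ℕ) //
      Sum.elim (IsGroupedArndt (-j) (n - 2)) (IsGroupedArndt (-j) (n - 2)) s} where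
  toFun s := ⟨shrinkPair j s.1, by
    obtain ⟨(⟨_ | ⟨⟨a, b⟩, p⟩, c⟩ | ⟨p, d⟩), h⟩ := s
    · obtain ⟨⟨-, h⟩, h'⟩ := h
      simp at h h'
      omega
    · obtain ⟨h, rfl : c = 0⟩ := h
      rw [isGroupedArndt_cons] at h
      obtain ⟨⟨ha, hb, hab⟩, h⟩ := h
      simp only [shrinkPair] at *
      split_ifs with h1 h2
      · exact h.of_add_eq (by omega)
      · exact h.of_add_eq (by omega)
      · exact (isGroupedArndt_cons ..).2
          ⟨⟨by grind, by grind, by grind⟩, h.of_add_eq (by grind)⟩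
    · exact IsGroupedArndt.of_add_eq h (by grind)⟩
  invFun s := ⟨growPair j s.1, by
    obtain ⟨(⟨p, c⟩ | ⟨_ | ⟨⟨a, b⟩, p⟩, _ | c⟩), h⟩ := s
    · exact ⟨(isGroupedArndt_cons ..).2
        ⟨⟨by grind, by grind, by grind⟩, IsGroupedArndt.of_add_eq h (by grind)⟩, rfl⟩
    · obtain ⟨-, h⟩ := h
      simp at h
      omega
    · simp only [growPair]
      split_ifs with hc
      · exact ⟨(isGroupedArndt_cons ..).2
          ⟨⟨by grind, by grind, by grind⟩, IsGroupedArndt.of_add_eq h (by grind)⟩, rfl⟩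
      · exact IsGroupedArndt.of_add_eq h (by grind)
    · obtain ⟨⟨ha, hb, hab⟩, h⟩ := (isGroupedArndt_cons ..).1 h
      exact ⟨(isGroupedArndt_cons ..).2
        ⟨⟨by grind, by grind, by grind⟩, IsGroupedArndt.of_add_eq h (by grind)⟩, rfl⟩
    · simp only [growPair]
      split_ifs with hc
      · exact ⟨(isGroupedArndt_cons ..).2
          ⟨⟨by grind, by grind, by grind⟩, IsGroupedArndt.of_add_eq h (by grind)⟩, rfl⟩
      · exact IsGroupedArndt.of_add_eq h (by grind)⟩
  left_inv s := by
    apply Subtype.ext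
    obtain ⟨(⟨_ | ⟨⟨a, b⟩, p⟩, c⟩ | ⟨p, d⟩), h⟩ := s
    · obtain ⟨⟨-, h⟩, h'⟩ := h
      simp at h h'
      omega
    · obtain ⟨h, rfl : c = 0⟩ := h
      obtain ⟨⟨ha, hb, hab⟩, -⟩ := (isGroupedArndt_cons ..).1 h
      obtain ⟨a, rfl⟩ := Nat.exists_eq_add_of_lt ha
      obtain ⟨b, rfl⟩ := Nat.exists_eq_add_of_lt hb
      rcases b with _ | b <;> rcases a with _ | a <;> simp [shrinkPair, growPair]
      grind
    · obtain ⟨j, rfl⟩ := Nat.exists_eq_add_of_lt hj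
      simp [shrinkPair, growPair, ← add_assoc]
  right_inv s := by
    apply Subtype.ext
    obtain ⟨(⟨p, c⟩ | ⟨_ | ⟨⟨a, b⟩, p⟩, _ | c⟩), h⟩ := s
    · simp [shrinkPair, growPair]
    · obtain ⟨-, h⟩ := h
      simp at h
      omega
    · simp only [growPair]
      split_ifs with hc
      · simp [shrinkPair]
      · simp [shrinkPair]; omega
    · obtain ⟨⟨ha, hb, hab⟩, h⟩ := (isGroupedArndt_cons ..).1 h
      dsimp only at ha hb
      simp [shrinkPair, growPair, ha.ne', hb.ne']
    · simp only [growPair]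
      split_ifs with hc
      · simp [shrinkPair]
      · simp [shrinkPair]; omega

theorem card_even_add_card_eq (j : ℕ) (hj : 0 < j) (n : ℤ) (hn : 3 ≤ n) :
    Nat.card {x // IsGroupedArndt (-j) n x ∧ x.2 = 0} +
        Nat.card {x // IsGroupedArndt (-j) (n - 2 + -j) x} =
      Nat.card {x // IsGroupedArndt (-j) (n - 2) x} +
        Nat.card {x // IsGroupedArndt (-j) (n - 2) x} := by
  have : Finite {x // IsGroupedArndt (-j) n x ∧ x.2 = 0} :=
    Finite.of_injective (fun x => (⟨x.1, x.2.1⟩ : {x // IsGroupedArndt (-j) n x}))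
      fun x y h => Subtype.ext (by simpa using h)
  rw [← Nat.card_sum, ← Nat.card_sum]
  exact Nat.card_congr <|
    (Equiv.subtypeSum.symm.trans (shrinkPairEquiv j hj n hn)).trans Equiv.subtypeSum

/-- For `k < 0`, the number of compositions in `A(n,k)` with an even number of
parts equals `2·a(n-2,k) - a(n-2+k,k)`. -/
theorem arndt_even_length_count (k : ℤ) (hk : k < 0) (a : ℤ → ℕ)
    (ha0 : a 0 = 1) (haneg : ∀ m : ℤ, m < 0 → a m = 0)
    (hapos : ∀ m : ℤ, 0 < m →
      a m = Nat.card {l : List ℕ // IsComposition m l ∧ ArndtCondK k l}) :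
    ∀ n : ℤ, 3 ≤ n →
      (Nat.card {l : List ℕ // IsComposition n l ∧ ArndtCondK k l ∧ Even l.length} : ℤ) =
        2 * a (n - 2) - a (n - 2 + k) := by
  intro n hn
  have ha (m : ℤ) : a m = Nat.card {x // IsGroupedArndt k m x} := by
    rw [← Nat.card_congr (arndtEquivGrouped k m)]
    rcases lt_trichotomy m 0 with hm | rfl | hm
    · rw [haneg m hm, eq_comm, Nat.card_eq_zero]
      refine .inl ⟨fun l => ?_⟩
      have := l.2.1.2
      omega
    · rw [ha0, eq_comm, Nat.card_eq_one_iff_exists]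
      refine ⟨⟨[], ⟨by simp, by simp⟩, arndtCondK_nil k⟩, ?_⟩
      rintro ⟨l, ⟨hpos, hsum⟩, -⟩
      have hl : l = [] := List.eq_nil_iff_forall_not_mem.2 fun x hx => by
        have := List.le_sum_of_mem hx
        have := hpos x hx
        omega
      exact Subtype.ext hl
    · exact hapos m hm
  obtain ⟨j, rfl⟩ : ∃ j : ℕ, k = -j := ⟨k.natAbs, by omega⟩
  have h := card_even_add_card_eq j (by omega) n hn
  rw [Nat.card_congr (evenArndtEquivGrouped _ n), ha, ha]
  omega
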